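/- Adjoint-state representation of the reduced gradient: Assume that for every direction v ∈ ℝᵐ the control-to-state map ξ ↦ u(t,ξ) is differentiable with derivative w(t) = D_ξ u(t,ξ)[v] solving the linearized state equation M₁ w'(t) = D_u F(u(t,ξ),ξ) w(t) + D_ξ F(u(t,ξ),ξ) v on [0,T] with w(0) = D u₀(ξ)[v], and let p : [0,T] → ℝⁿ solve the adjoint problem M₁ p'(t) = −(D_u F(u(t,ξ),ξ))ᵀ p(t) with terminal condition M₁ p(T) = u_D − u(T,ξ). Then the Gâteaux derivative of the reduced cost functional satisfies, for every v ∈ ℝᵐ, dĴ(ξ)[v] = −∫₀ᵀ (D_ξ F(u(t,ξ),ξ) v) · p(t) dt − (D u₀(ξ) v) · (M₁ p(0)) + δ (ξ − ξ_p) · v. -/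

import Mathlib

open Matrix intervalIntegral

theorem HasDerivAt.dotProduct_real {ι : Type*} [Fintype ι] {f g : ℝ → ι → ℝ} {f' g' : ι → ℝ}
    {t : ℝ} (hf : HasDerivAt f f' t) (hg : HasDerivAt g g' t) :
    HasDerivAt (fun s => f s ⬝ᵥ g s) (f' ⬝ᵥ g t + f t ⬝ᵥ g') t := by
  rw [hasDerivAt_pi] at hf hg
  simp only [dotProduct, ← Finset.sum_add_distrib]
  exact HasDerivAt.fun_sum fun i _ => (hf i).mul (hg i)

theorem HasDerivAt.const_mulVec_real {ι κ : Type*} [Fintype ι] [Fintype κ] (M : Matrix κ ι ℝ)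
    {f : ℝ → ι → ℝ} {f' : ι → ℝ} {t : ℝ} (hf : HasDerivAt f f' t) :
    HasDerivAt (fun s => M *ᵥ f s) (M *ᵥ f') t :=
  (LinearMap.toContinuousLinearMap M.mulVecLin).hasFDerivAt.comp_hasDerivAt t hf

/-- The derivative of half the squared Euclidean distance to a fixed vector along a curve. -/
theorem HasDerivAt.half_dotProduct_sub_self {ι : Type*} [Fintype ι] {f : ℝ → ι → ℝ} {f' : ι → ℝ}
    {t : ℝ} (hf : HasDerivAt f f' t) (c : ℝ) (a : ι → ℝ) :
    HasDerivAt (fun s => c / 2 * ((f s - a) ⬝ᵥ (f s - a))) (c * ((f t - a) ⬝ᵥ f')) t := by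
  have h := hf.sub_const a
  refine ((h.dotProduct_real h).const_mul (c / 2)).congr_deriv ?_
  rw [dotProduct_comm f']
  ring

/-- **Adjoint-state representation of the reduced gradient.**
In the semi-discrete setting (`M₁ u' = F(u,ξ)`, `u(0) = u₀(ξ)`), assume that
for every direction `v` the control-to-state map is (Gâteaux) differentiable
with derivative `w(t) = D_ξ u(t,ξ)[v]` solving the linearized equation
`M₁ w' = D_u F(u,ξ) w + D_ξ F(u,ξ) v`, `w(0) = D u₀(ξ)[v]`, and let `p` solve
the adjoint problem `M₁ p' = −(D_u F(u,ξ),ξ)ᵀ p` with terminal condition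
`M₁ p(T) = u_D − u(T,ξ)`.  Then the Gâteaux derivative of the reduced cost
`Ĵ(ξ) = (1/2)‖u(T,ξ) − u_D‖² + (δ/2)‖ξ − ξ_p‖²` satisfies, for every `v`,
`dĴ(ξ)[v] = −∫₀ᵀ (D_ξ F(u(t,ξ),ξ) v) · p(t) dt − (D u₀(ξ) v) · (M₁ p(0))
  + δ (ξ − ξ_p) · v`. -/
theorem adjoint_representation_reduced_gradient
    {n m : ℕ} (hn : 0 < n) (hm : 0 < m) (T : ℝ) (hT : 0 < T)
    (M₁ : Matrix (Fin n) (Fin n) ℝ) (hM₁ : M₁.IsSymm) (hM₁inv : IsUnit M₁.det)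
    (F : (Fin n → ℝ) → (Fin m → ℝ) → Fin n → ℝ)
    (Fu : (Fin n → ℝ) → (Fin m → ℝ) → Matrix (Fin n) (Fin n) ℝ)
    (Fξ : (Fin n → ℝ) → (Fin m → ℝ) → Matrix (Fin n) (Fin m) ℝ)
    (hFu : ∀ x ζ, HasFDerivAt (fun y => F y ζ)
      (LinearMap.toContinuousLinearMap (Fu x ζ).mulVecLin) x)
    (hFξ : ∀ x ζ, HasFDerivAt (fun η => F x η)
      (LinearMap.toContinuousLinearMap (Fξ x ζ).mulVecLin) ζ)
    (hFuc : Continuous fun q : (Fin n → ℝ) × (Fin m → ℝ) => Fu q.1 q.2)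
    (hFξc : Continuous fun q : (Fin n → ℝ) × (Fin m → ℝ) => Fξ q.1 q.2)
    (u₀ : (Fin m → ℝ) → Fin n → ℝ)
    (Du₀ : (Fin m → ℝ) → Matrix (Fin n) (Fin m) ℝ)
    (hu₀ : ∀ ζ, HasFDerivAt u₀
      (LinearMap.toContinuousLinearMap (Du₀ ζ).mulVecLin) ζ)
    (hDu₀c : Continuous Du₀)
    (uD : Fin n → ℝ) (ξp : Fin m → ℝ) (δ : ℝ) (hδ : 0 ≤ δ)
    (u du : ℝ → (Fin m → ℝ) → Fin n → ℝ)
    (hu0 : ∀ ζ, u 0 ζ = u₀ ζ)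
    (hu' : ∀ ζ, ∀ t ∈ Set.Icc (0 : ℝ) T, HasDerivAt (fun s => u s ζ) (du t ζ) t)
    (hu'c : ∀ ζ, ContinuousOn (fun t => du t ζ) (Set.Icc (0 : ℝ) T))
    (hstate : ∀ ζ, ∀ t ∈ Set.Icc (0 : ℝ) T, M₁ *ᵥ du t ζ = F (u t ζ) ζ)
    (w dw : (Fin m → ℝ) → (Fin m → ℝ) → ℝ → Fin n → ℝ)
    (hgateaux : ∀ ζ v, ∀ t ∈ Set.Icc (0 : ℝ) T,
      Filter.Tendsto (fun ε : ℝ => ε⁻¹ • (u t (ζ + ε • v) - u t ζ))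
        (nhdsWithin 0 {0}ᶜ) (nhds (w ζ v t)))
    (hw' : ∀ ζ v, ∀ t ∈ Set.Icc (0 : ℝ) T, HasDerivAt (w ζ v) (dw ζ v t) t)
    (hlin : ∀ ζ v, ∀ t ∈ Set.Icc (0 : ℝ) T,
      M₁ *ᵥ dw ζ v t = Fu (u t ζ) ζ *ᵥ w ζ v t + Fξ (u t ζ) ζ *ᵥ v)
    (hw0 : ∀ ζ v, w ζ v 0 = Du₀ ζ *ᵥ v)
    (Jhat : (Fin m → ℝ) → ℝ)
    (hJhat : ∀ ζ, Jhat ζ = (1/2) * ((u T ζ - uD) ⬝ᵥ (u T ζ - uD))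
      + (δ/2) * ((ζ - ξp) ⬝ᵥ (ζ - ξp)))
    -- the control at which the gradient is represented
    (ξ : Fin m → ℝ)
    -- the adjoint state
    (p dp : ℝ → Fin n → ℝ)
    (hp' : ∀ t ∈ Set.Icc (0 : ℝ) T, HasDerivAt p (dp t) t)
    (hp'c : ContinuousOn dp (Set.Icc (0 : ℝ) T))
    (hadj : ∀ t ∈ Set.Icc (0 : ℝ) T,
      M₁ *ᵥ dp t = -((Fu (u t ξ) ξ)ᵀ *ᵥ p t))
    (hterm : M₁ *ᵥ p T = uD - u T ξ) :
    ∀ v : Fin m → ℝ,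
      Filter.Tendsto (fun ε : ℝ => (Jhat (ξ + ε • v) - Jhat ξ) / ε)
        (nhdsWithin 0 {0}ᶜ)
        (nhds (-(∫ t in (0 : ℝ)..T, (Fξ (u t ξ) ξ *ᵥ v) ⬝ᵥ p t)
          - (Du₀ ξ *ᵥ v) ⬝ᵥ (M₁ *ᵥ p 0)
          + δ * ((ξ - ξp) ⬝ᵥ v))) := by
  intro v
  have hg : ∀ t ∈ Set.Icc (0 : ℝ) T, HasDerivAt (fun s => w ξ v s ⬝ᵥ (M₁ *ᵥ p s))
      ((Fξ (u t ξ) ξ *ᵥ v) ⬝ᵥ p t) t := by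
    intro t ht
    refine ((hw' ξ v t ht).dotProduct_real ((hp' t ht).const_mulVec_real M₁)).congr_deriv ?_
    rw [hadj t ht, dotProduct_mulVec, ← mulVec_transpose, hM₁.eq, hlin ξ v t ht, add_dotProduct,
      dotProduct_neg, dotProduct_mulVec (w ξ v t), vecMul_transpose]
    ring
  have hu_cont : ContinuousOn (fun t => u t ξ) (Set.Icc 0 T) := fun t ht =>
    (hu' ξ t ht).continuousAt.continuousWithinAt
  have hp_cont : ContinuousOn p (Set.Icc 0 T) := fun t ht =>
    (hp' t ht).continuousAt.continuousWithinAt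
  have hFξ_cont : ContinuousOn (fun t => Fξ (u t ξ) ξ) (Set.Icc 0 T) :=
    hFξc.comp_continuousOn (hu_cont.prodMk continuousOn_const)
  have hint_cont : ContinuousOn (fun t => (Fξ (u t ξ) ξ *ᵥ v) ⬝ᵥ p t) (Set.Icc 0 T) := by
    rw [continuousOn_iff_continuous_domRestrict] at hFξ_cont hp_cont ⊢
    exact (hFξ_cont.matrix_mulVec continuous_const).dotProduct hp_cont
  have hftc : ∫ t in (0 : ℝ)..T, (Fξ (u t ξ) ξ *ᵥ v) ⬝ᵥ p t =
      w ξ v T ⬝ᵥ (M₁ *ᵥ p T) - w ξ v 0 ⬝ᵥ (M₁ *ᵥ p 0) := by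
    rw [← Set.uIcc_of_le hT.le] at hg hint_cont
    exact integral_eq_sub_of_hasDerivAt hg hint_cont.intervalIntegrable
  have hstateT : HasDerivAt (fun ε : ℝ => u T (ξ + ε • v)) (w ξ v T) 0 := by
    rw [hasDerivAt_iff_tendsto_slope_zero]
    simpa using hgateaux ξ v T (Set.right_mem_Icc.2 hT.le)
  have hcontrol : HasDerivAt (fun ε : ℝ => ξ + ε • v) v 0 := by
    simpa using ((hasDerivAt_id (0 : ℝ)).smul_const v).const_add ξ
  have hJ : HasDerivAt (fun ε : ℝ => Jhat (ξ + ε • v))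
      ((u T ξ - uD) ⬝ᵥ w ξ v T + δ * ((ξ - ξp) ⬝ᵥ v)) 0 := by
    simp only [hJhat]
    refine ((hstateT.half_dotProduct_sub_self 1 uD).fun_add
      (hcontrol.half_dotProduct_sub_self δ ξp)).congr_deriv ?_
    simp only [zero_smul, add_zero, one_mul]
  rw [hasDerivAt_iff_tendsto_slope_zero] at hJ
  convert hJ using 2
  · simp [div_eq_inv_mul]
  · rw [hftc, hterm, hw0, dotProduct_comm (w ξ v T), ← neg_sub (u T ξ) uD, neg_dotProduct]
    ring
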